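/- The Jacobson radical R(n,p) of the p-modular descent algebra Σ(n,p) equals the kernel of the homomorphism φ : Σ(n,p) → G(n,p). -/

import Mathlib

open scoped Classical

set_option synthInstance.maxHeartbeats 1000000
set_option maxHeartbeats 1000000

noncomputable section

/-- The group algebra `F_p[S_n]`. -/
abbrev GroupAlg (n p : ℕ) : Type := MonoidAlgebra (ZMod p) (Equiv.Perm (Fin n))

/-- The descent set of a permutation `σ` of `{1,…,n}` (1-based positions):
`k ∈ {1,…,n-1}` is a descent if `σ(k) > σ(k+1)`.  (With 0-based `Fin n` indices this
compares the images at indices `k-1` and `k`.) -/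
def descSet {n : ℕ} (σ : Equiv.Perm (Fin n)) : Set ℕ :=
  {k | ∃ h : k < n, 0 < k ∧ σ ⟨k, h⟩ < σ ⟨k - 1, by omega⟩}

/-- The set of proper partial sums `{a_1, a_1+a_2, …, a_1+⋯+a_{s-1}}` of a composition. -/
def properPartialSums {n : ℕ} (q : Composition n) : Set ℕ :=
  {m | ∃ i : ℕ, 0 < i ∧ i < q.length ∧ m = q.sizeUpTo i}

/-- `B̄_q`: the sum of all permutations whose descent set is contained in the set of
proper partial sums of `q`. -/
def Bel (n p : ℕ) (q : Composition n) : GroupAlg n p :=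
  ∑ σ ∈ Finset.univ.filter
      (fun σ : Equiv.Perm (Fin n) => descSet σ ⊆ properPartialSums q),
    MonoidAlgebra.of (ZMod p) (Equiv.Perm (Fin n)) σ

/-- The p-modular descent algebra `Σ(n,p)`, as a subalgebra of the group algebra. -/
def descentAlgebra (n p : ℕ) : Subalgebra (ZMod p) (GroupAlg n p) :=
  Algebra.adjoin (ZMod p) (Set.range (Bel n p))

/-- `B̄_q` as an element of `Σ(n,p)`. -/
def BelS (n p : ℕ) (q : Composition n) : descentAlgebra n p :=
  ⟨Bel n p q, Algebra.subset_adjoin ⟨q, rfl⟩⟩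

/-- The Jacobson radical `R(n,p)` of `Σ(n,p)`. -/
def descentRadical (n p : ℕ) : Ideal (descentAlgebra n p) :=
  (⊥ : Ideal (descentAlgebra n p)).jacobson

/-- `R(n,p)` viewed as an `F_p`-subspace of the group algebra. -/
def descentRadicalSubmodule (n p : ℕ) : Submodule (ZMod p) (GroupAlg n p) :=
  Submodule.map (descentAlgebra n p).val.toLinearMap
    ((descentRadical n p).restrictScalars (ZMod p))

/-- `Y_m`: the span of the `B̄_q` with `q` having at least `m` components. -/
def Ysub (n p m : ℕ) : Submodule (ZMod p) (GroupAlg n p) :=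
  Submodule.span (ZMod p) {x | ∃ q : Composition n, m ≤ q.length ∧ x = Bel n p q}

/-- `T`: the span of all differences `B̄_q - B̄_r` with `q ≈ r`. -/
def Tsub (n p : ℕ) : Submodule (ZMod p) (GroupAlg n p) :=
  Submodule.span (ZMod p)
    {x | ∃ q r : Composition n, q.blocks.Perm r.blocks ∧ x = Bel n p q - Bel n p r}

/-- `g(n,p)`: the number of partitions of `n` with no part divisible by `p`. -/
def gPart (n p : ℕ) : ℕ := Set.ncard {π : n.Partition | ∀ i ∈ π.parts, ¬ p ∣ i}

/-- `g(n,p)`: the number of conjugacy classes of `p`-regular elements of `S_n`. -/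
def gReg (n p : ℕ) : ℕ :=
  Set.ncard {c : ConjClasses (Equiv.Perm (Fin n)) | ∀ σ ∈ c.carrier, (orderOf σ).Coprime p}

/-- The Young character `χ_q`: `χ_q(σ)` is the number of ordered set partitions
`(P_1,…,P_s)` of `{1,…,n}` with `|P_i| = a_i`, each of whose blocks is `σ`-invariant. -/
def youngChar {n : ℕ} (q : Composition n) (σ : Equiv.Perm (Fin n)) : ℕ :=
  (Finset.univ.filter (fun P : Fin q.length → Finset (Fin n) =>
    (∀ i, (P i).card = q.blocksFun i) ∧
    (∀ i j, i ≠ j → Disjoint (P i) (P j)) ∧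
    (∀ x, ∃ i, x ∈ P i) ∧
    (∀ i, ∀ x ∈ P i, σ x ∈ P i))).card

/-- `χ̃_q`: the Young character with values reduced mod `p`. -/
def youngCharMod (n p : ℕ) (q : Composition n) : Equiv.Perm (Fin n) → ZMod p :=
  fun σ => (youngChar q σ : ZMod p)

/-- `G(n,p)`: the span of the mod-`p` Young characters. -/
def Gnp (n p : ℕ) : Submodule (ZMod p) (Equiv.Perm (Fin n) → ZMod p) :=
  Submodule.span (ZMod p) (Set.range (youngCharMod n p))

/-- `S(q,r)`: matrices with row sums `q` and column sums `r`. -/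
def SMat {n : ℕ} (q r : Composition n) : Set (Matrix (Fin q.length) (Fin r.length) ℕ) :=
  {Z | (∀ i, ∑ j, Z i j = q.blocksFun i) ∧ (∀ j, ∑ i, Z i j = r.blocksFun j)}

/-- `w(Z)`: the list of nonzero entries of `Z` read row by row. -/
def wList {s t : ℕ} (Z : Matrix (Fin s) (Fin t) ℕ) : List ℕ :=
  ((List.finRange s).flatMap fun i => ((List.finRange t).map fun j => Z i j)).filter
    (fun x => x ≠ 0)

/-- One merging step: replace two adjacent components by their sum. -/
def mergeStep (l l' : List ℕ) : Prop :=
  ∃ (u v : List ℕ) (a b : ℕ), l = u ++ a :: b :: v ∧ l' = u ++ (a + b) :: v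

/-- `coarsens l l'` (`l ⪯ l'` on compositions): `l'` is obtained from `l` by repeatedly
replacing adjacent components by their sum. -/
def coarsens (l l' : List ℕ) : Prop := Relation.ReflTransGen mergeStep l l'

section LeftRegularBand

variable {k M : Type*} [CommRing k] [Monoid M]

/-- In a left regular band, `g * x * y = g` exactly when both `x` and `y` fix `g` on the right. -/
theorem mul_mul_eq_self_iff_of_leftRegularBand (hM : ∀ x y : M, x * y * x = x * y) (g x y : M) :
    g * (x * y) = g ↔ g * x = g ∧ g * y = g := by
  constructor
  · intro h
    have hx : g * x = g := by
      calc g * x = g * (x * y) * x := by rw [h]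
        _ = g * (x * y * x) := by rw [mul_assoc]
        _ = g := by rw [hM, h]
    refine ⟨hx, ?_⟩
    rwa [← mul_assoc, hx] at h
  · rintro ⟨hx, hy⟩
    rw [← mul_assoc, hx, hy]

/-- The indicator of the right stabilizer of `g`, a character of a left regular band. -/
def stabilizerChar (k : Type*) [CommRing k] (hM : ∀ x y : M, x * y * x = x * y) (g : M) :
    M →* k where
  toFun x := if g * x = g then 1 else 0
  map_one' := by simp
  map_mul' x y := by
    rw [ite_zero_mul_ite_zero, one_mul]
    simp only [mul_mul_eq_self_iff_of_leftRegularBand hM]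

theorem stabilizerChar_apply (hM : ∀ x y : M, x * y * x = x * y) (g x : M) :
    stabilizerChar k hM g x = if g * x = g then 1 else 0 := rfl

/-- The span of the elements whose right stabilizer has at least `d` elements. -/
def stabilizerFiltration (k M : Type*) [CommRing k] [Monoid M] (d : ℕ) :
    Submodule k (MonoidAlgebra k M) :=
  Submodule.span k {v | ∃ g : M, d ≤ Set.ncard {x | g * x = g} ∧ v = MonoidAlgebra.single g 1}

theorem ncard_stabilizer_lt_of_mul_ne [Finite M] (hM : ∀ x y : M, x * y * x = x * y) {g y : M}
    (h : g * y ≠ g) : Set.ncard {x | g * x = g} < Set.ncard {x | g * y * x = g * y} := by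
  refine Set.ncard_lt_ncard ?_ (Set.toFinite _)
  refine (Set.ssubset_iff_of_subset ?_).2 ⟨y, ?_, h⟩
  · intro x hx
    have hx : g * x = g := hx
    change g * y * x = g * y
    calc g * y * x = g * (x * y * x) := by rw [← mul_assoc g, ← mul_assoc g, hx]
      _ = g * y := by rw [hM, ← mul_assoc, hx]
  · change g * y * y = g * y
    have := hM y 1
    rw [mul_one] at this
    rw [mul_assoc, this]

theorem single_mul_sub_stabilizerChar_smul_mem [Finite M] (hM : ∀ x y : M, x * y * x = x * y)
    (g : M) (a : MonoidAlgebra k M) :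
    MonoidAlgebra.single g 1 * a
        - MonoidAlgebra.lift k k M (stabilizerChar k hM g) a • MonoidAlgebra.single g 1 ∈
      stabilizerFiltration k M (Set.ncard {x | g * x = g} + 1) := by
  induction a using MonoidAlgebra.induction_linear with
  | zero => simp
  | add a b ha hb =>
    rw [mul_add, map_add, add_smul, add_sub_add_comm]
    exact add_mem ha hb
  | single y r =>
    rw [MonoidAlgebra.single_mul_single, MonoidAlgebra.lift_single, stabilizerChar_apply]
    split_ifs with h
    · simp [h, MonoidAlgebra.smul_single]
    · have : MonoidAlgebra.single (g * y) (1 * r) = r • MonoidAlgebra.single (g * y) (1 : k) := by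
        simp [MonoidAlgebra.smul_single]
      rw [smul_zero, zero_smul, sub_zero, this]
      exact Submodule.smul_mem _ _ (Submodule.subset_span
        ⟨_, ncard_stabilizer_lt_of_mul_ne hM h, rfl⟩)

theorem mul_mem_stabilizerFiltration [Finite M] (hM : ∀ x y : M, x * y * x = x * y)
    {a : MonoidAlgebra k M}
    (ha : ∀ g, MonoidAlgebra.lift k k M (stabilizerChar k hM g) a = 0) {d : ℕ}
    {v : MonoidAlgebra k M} (hv : v ∈ stabilizerFiltration k M d) :
    v * a ∈ stabilizerFiltration k M (d + 1) := by
  induction hv using Submodule.span_induction with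
  | zero => simp
  | add v w _ _ hv hw => rw [add_mul]; exact add_mem hv hw
  | smul r v _ hv => rw [smul_mul_assoc]; exact Submodule.smul_mem _ _ hv
  | mem v hv =>
    obtain ⟨g, hg, rfl⟩ := hv
    have := single_mul_sub_stabilizerChar_smul_mem hM g a
    rw [ha, zero_smul, sub_zero] at this
    refine Submodule.span_mono ?_ this
    rintro _ ⟨x, hx, rfl⟩
    exact ⟨x, by omega, rfl⟩

/-- An element of the algebra of a finite left regular band that is killed by all stabilizer
characters is nilpotent. -/
theorem isNilpotent_of_stabilizerChar_eq_zero [Finite M] (hM : ∀ x y : M, x * y * x = x * y)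
    {a : MonoidAlgebra k M}
    (ha : ∀ g, MonoidAlgebra.lift k k M (stabilizerChar k hM g) a = 0) : IsNilpotent a := by
  have hpow : ∀ d, a ^ d ∈ stabilizerFiltration k M d := by
    intro d
    induction d with
    | zero => exact Submodule.subset_span ⟨1, Nat.zero_le _, MonoidAlgebra.one_def⟩
    | succ d ih => rw [pow_succ]; exact mul_mem_stabilizerFiltration hM ha ih
  refine ⟨Nat.card M + 1, ?_⟩
  have h := hpow (Nat.card M + 1)
  have hbot : stabilizerFiltration k M (Nat.card M + 1) = ⊥ := by
    refine Submodule.span_eq_bot.2 ?_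
    rintro _ ⟨g, hg, -⟩
    have := Set.ncard_le_card {x : M | g * x = g}
    omega
  rwa [hbot, Submodule.mem_bot] at h

end LeftRegularBand

section OrbitRelation

variable {α : Type*} [Finite α]

/-- Every equivalence relation on a finite type is the orbit relation of a permutation. -/
theorem exists_perm_sameCycle_iff (r : Setoid α) :
    ∃ σ : Equiv.Perm α, ∀ x y, σ.SameCycle x y ↔ r x y := by
  have hex : ∀ q : Quotient r, ∃ f : Equiv.Perm α, f.IsCycleOn {x | Quotient.mk r x = q} :=
    fun q => (Set.Countable.exists_cycleOn (Set.toFinite _).countable).imp fun _ h => h.1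
  choose f hf using hex
  have hmk : ∀ x q, Quotient.mk r x = q → Quotient.mk r (f q x) = q :=
    fun x q hx => (hf q).1.mapsTo hx
  have hinj : Function.Injective fun x => f (Quotient.mk r x) x := by
    intro x y hxy
    have hxy : f (Quotient.mk r x) x = f (Quotient.mk r y) y := hxy
    have hq : Quotient.mk r x = Quotient.mk r y := by
      rw [← hmk x _ rfl, hxy, hmk y _ rfl]
    rw [hq] at hxy
    exact (f _).injective hxy
  let σ : Equiv.Perm α := Equiv.ofBijective _ (Finite.injective_iff_bijective.1 hinj)
  have hσ : ∀ x, σ x = f (Quotient.mk r x) x := fun _ => rfl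
  have hpow : ∀ (m : ℕ) x q, Quotient.mk r x = q →
      (σ ^ m) x = (f q ^ m) x ∧ Quotient.mk r ((σ ^ m) x) = q := by
    intro m x q hx
    induction m with
    | zero => exact ⟨rfl, hx⟩
    | succ m ih =>
      rw [pow_succ', pow_succ', Equiv.Perm.mul_apply, Equiv.Perm.mul_apply, hσ, ih.2, ← ih.1]
      exact ⟨rfl, hmk _ _ ih.2⟩
  refine ⟨σ, fun x y => ⟨fun h => ?_, fun h => ?_⟩⟩
  · obtain ⟨m, rfl⟩ := h.exists_nat_pow_eq
    exact Quotient.exact (hpow m x _ rfl).2.symm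
  · obtain ⟨m, hm⟩ := (hf (Quotient.mk r x)).exists_pow_eq' (Set.toFinite _)
      (show Quotient.mk r x = _ from rfl) (show Quotient.mk r y = _ from (Quotient.sound h).symm)
    exact ⟨m, by rw [zpow_natCast, (hpow m x _ rfl).1, hm]⟩

theorem comp_perm_eq_iff_of_sameCycle_iff {β : Type*} {r : Setoid α} {σ : Equiv.Perm α}
    (hσ : ∀ x y, σ.SameCycle x y ↔ r x y) (c : α → β) :
    (∀ x, c (σ x) = c x) ↔ ∀ x y, r x y → c x = c y := by
  constructor
  · intro h x y hxy
    obtain ⟨m, rfl⟩ := ((hσ x y).2 hxy).exists_nat_pow_eq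
    induction m with
    | zero => rfl
    | succ m ih =>
      rw [pow_succ', Equiv.Perm.mul_apply, h]
      exact ih ((hσ _ _).1 ⟨m, by simp⟩)
  · intro h x
    exact (h _ _ ((hσ _ _).1 ⟨1, by simp⟩)).symm

end OrbitRelation

/-- Binary relations on `α`, viewed as a monoid under lexicographic composition. -/
def LexRel (α : Type*) : Type _ := α → α → Prop

namespace LexRel

variable {α : Type*}

theorem ext {R S : LexRel α} (h : ∀ x y, R x y ↔ S x y) : R = S :=
  funext fun x => funext fun y => propext (h x y)

/-- `R * S` compares by `R` first and breaks ties using `S`. -/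
instance : Monoid (LexRel α) where
  mul R S := fun x y => R x y ∧ (R y x → S x y)
  one := fun _ _ => True
  mul_assoc R S T := ext fun x y => show
    ((R x y ∧ (R y x → S x y)) ∧ ((R y x ∧ (R x y → S y x)) → T x y)) ↔
      (R x y ∧ (R y x → S x y ∧ (S y x → T x y))) by tauto
  one_mul S := ext fun x y => show (True ∧ (True → S x y)) ↔ S x y by tauto
  mul_one R := ext fun x y => show (R x y ∧ (R y x → True)) ↔ R x y by tauto

instance [Finite α] : Finite (LexRel α) := inferInstanceAs (Finite (α → α → Prop))

theorem mul_apply (R S : LexRel α) (x y : α) : (R * S) x y ↔ R x y ∧ (R y x → S x y) := Iff.rfl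

theorem mul_mul_self (R S : LexRel α) : R * S * R = R * S :=
  ext fun x y => by simp only [mul_apply]; tauto

/-- The preorder on `α` pulled back along `c`. -/
def ofFun {β : Type*} [LE β] (c : α → β) : LexRel α := fun x y => c x ≤ c y

theorem ofFun_apply {β : Type*} [LE β] (c : α → β) (x y : α) : ofFun c x y ↔ c x ≤ c y := Iff.rfl

theorem mul_ofFun_eq_self_iff {β : Type*} [PartialOrder β] (R : LexRel α) (c : α → β) :
    R * ofFun c = R ↔
      ∀ x y, (Relation.EqvGen.setoid fun x y => R x y ∧ R y x) x y → c x = c y := by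
  constructor
  · intro h x y hxy
    have hle : ∀ x y, R x y → R y x → c x ≤ c y := by
      intro x y hxy hyx
      rw [← h] at hxy
      exact hxy.2 hyx
    induction hxy with
    | rel x y hxy => exact le_antisymm (hle _ _ hxy.1 hxy.2) (hle _ _ hxy.2 hxy.1)
    | refl x => rfl
    | symm x y _ ih => exact ih.symm
    | trans x y z _ _ ih₁ ih₂ => exact ih₁.trans ih₂
  · intro h
    refine ext fun x y => ⟨fun hxy => hxy.1, fun hxy => ⟨hxy, fun hyx => ?_⟩⟩
    exact (h x y (Relation.EqvGen.rel _ _ ⟨hxy, hyx⟩)).le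

end LexRel

namespace Composition

variable {n : ℕ} (q : Composition n)

theorem index_monotone : Monotone q.index := by
  intro x y hxy
  by_contra! h
  have h₁ := q.lt_sizeUpTo_index_succ y
  have h₂ := q.sizeUpTo_index_le x
  have h₃ : q.sizeUpTo (q.index y).succ ≤ q.sizeUpTo (q.index x) := q.monotone_sizeUpTo h
  have h₄ : (x : ℕ) ≤ y := hxy
  omega

theorem card_filter_index_eq (i : Fin q.length) :
    (Finset.univ.filter fun x => q.index x = i).card = q.blocksFun i := by
  have : (Finset.univ.filter fun x => q.index x = i) =
      Finset.univ.map (q.embedding i).toEmbedding := by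
    ext x
    simp only [Finset.mem_filter, Finset.mem_univ, true_and, Finset.mem_map]
    constructor
    · rintro rfl
      exact ⟨q.invEmbedding x, q.embedding_comp_inv x⟩
    · rintro ⟨j, rfl⟩
      exact q.index_embedding i j
  rw [this, Finset.card_map, Finset.card_univ, Fintype.card_fin]

theorem index_pred_eq_iff {m : ℕ} (hm : 0 < m) (hmn : m < n) :
    q.index ⟨m - 1, by omega⟩ = q.index ⟨m, hmn⟩ ↔ m ∉ properPartialSums q := by
  have hle := q.index_monotone (show (⟨m - 1, by omega⟩ : Fin n) ≤ ⟨m, hmn⟩ from Nat.sub_le _ _)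
  have h₁ := q.lt_sizeUpTo_index_succ ⟨m - 1, by omega⟩
  have h₂ := q.sizeUpTo_index_le ⟨m, hmn⟩
  constructor
  · rintro h ⟨i, hi, hil, rfl⟩
    have h₃ := q.sizeUpTo_index_le ⟨q.sizeUpTo i - 1, by omega⟩
    have h₄ := q.lt_sizeUpTo_index_succ ⟨q.sizeUpTo i, hmn⟩
    rw [h] at h₃
    simp only [Fin.val_succ] at h₁ h₂ h₃ h₄
    rcases lt_or_ge (q.index ⟨q.sizeUpTo i, hmn⟩ : ℕ) i with hlt | hge
    · have := q.monotone_sizeUpTo (Nat.succ_le_of_lt hlt)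
      simp only [Nat.succ_eq_add_one] at this
      omega
    · have := q.monotone_sizeUpTo hge
      omega
  · intro h
    by_contra hne
    have hlt : q.index ⟨m - 1, by omega⟩ < q.index ⟨m, hmn⟩ := lt_of_le_of_ne hle hne
    have h₃ : q.sizeUpTo (q.index ⟨m - 1, by omega⟩).succ ≤ q.sizeUpTo (q.index ⟨m, hmn⟩) :=
      q.monotone_sizeUpTo hlt
    simp only [Fin.val_succ] at h₁ h₂ h₃
    exact h ⟨q.index ⟨m, hmn⟩, Nat.lt_of_le_of_lt (Nat.zero_le _) hlt, Fin.is_lt _, by omega⟩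

theorem descSet_subset_properPartialSums_iff (τ : Equiv.Perm (Fin n)) :
    descSet τ ⊆ properPartialSums q ↔ ∀ x y, x < y → q.index x = q.index y → τ x < τ y := by
  constructor
  · rintro h ⟨x, hx⟩ ⟨y, hy⟩ hxy
    have hxy : x < y := hxy
    induction y, hxy using Nat.le_induction with
    | base =>
      intro hq
      have := mt (@h (x + 1)) ((q.index_pred_eq_iff x.succ_pos hy).1 hq)
      simp only [descSet, Set.mem_ofPred_eq, not_exists, not_and, not_lt] at this
      refine lt_of_le_of_ne (this hy x.succ_pos) fun he => ?_
      simpa using τ.injective he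
    | succ y hle ih =>
      intro hq
      have hy' : y < n := by omega
      have h₁ : q.index ⟨x, hx⟩ ≤ q.index ⟨y, hy'⟩ :=
        q.index_monotone (show x ≤ y from Nat.le_of_succ_le hle)
      have h₂ : q.index ⟨y, hy'⟩ ≤ q.index ⟨y + 1, hy⟩ :=
        q.index_monotone (show y ≤ y + 1 by omega)
      have h₃ : q.index ⟨y, hy'⟩ = q.index ⟨y + 1, hy⟩ := le_antisymm h₂ (hq ▸ h₁)
      refine lt_trans (ih hy' hle (hq.trans h₃.symm)) ?_
      have := mt (@h (y + 1)) ((q.index_pred_eq_iff y.succ_pos hy).1 h₃)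
      simp only [descSet, Set.mem_ofPred_eq, not_exists, not_and, not_lt] at this
      refine lt_of_le_of_ne (this hy y.succ_pos) fun he => ?_
      simpa using τ.injective he
  · rintro h m ⟨hmn, hm, hlt⟩
    by_contra hq
    have := h ⟨m - 1, by omega⟩ ⟨m, hmn⟩ (show m - 1 < m by omega)
      ((q.index_pred_eq_iff hm hmn).2 hq)
    exact lt_asymm this hlt

/-- Functions `c : Fin n → Fin q.length` with fibres of sizes prescribed by `q`, encoding
ordered set partitions of type `q`. -/
def colorings : Finset (Fin n → Fin q.length) :=
  Finset.univ.filter fun c => ∀ i, (Finset.univ.filter fun x => c x = i).card = q.blocksFun i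

variable {q}

theorem mem_colorings_iff {c : Fin n → Fin q.length} :
    c ∈ q.colorings ↔ ∃ π : Equiv.Perm (Fin n), c = q.index ∘ π := by
  simp only [colorings, Finset.mem_filter, Finset.mem_univ, true_and]
  constructor
  · intro h
    have e : ∀ i, Nonempty ({x // c x = i} ≃ {x // q.index x = i}) := fun i =>
      Fintype.card_eq.1 (by
        rw [Fintype.card_subtype, Fintype.card_subtype, q.card_filter_index_eq, h])
    exact ⟨Equiv.ofFiberEquiv fun i => (e i).some,
      funext fun x => (Equiv.ofFiberEquiv_map _ x).symm⟩
  · rintro ⟨π, rfl⟩ i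
    rw [← q.card_filter_index_eq i]
    exact Finset.card_equiv π fun x => by simp

theorem youngChar_eq_card (σ : Equiv.Perm (Fin n)) :
    youngChar q σ = (q.colorings.filter fun c => ∀ x, c (σ x) = c x).card := by
  symm
  refine Finset.card_bij (fun c _ i => Finset.univ.filter fun x => c x = i) ?_ ?_ ?_
  · intro c hc
    simp only [colorings, Finset.mem_filter, Finset.mem_univ, true_and] at hc ⊢
    refine ⟨hc.1, fun i j hij => ?_, fun x => ⟨_, rfl⟩, fun i x hx => (hc.2 x).trans hx⟩
    rw [Finset.disjoint_left]
    simp only [Finset.mem_filter, Finset.mem_univ, true_and]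
    exact fun x hi hj => hij (hi.symm.trans hj)
  · intro c _ d _ h
    funext x
    have := congrArg (x ∈ ·) (congrFun h (d x))
    simpa using this
  · intro P hP
    simp only [Finset.mem_filter, Finset.mem_univ, true_and] at hP
    obtain ⟨hcard, hdisj, hcover, hinv⟩ := hP
    choose c hc using hcover
    have huniq : ∀ x i, x ∈ P i → c x = i := by
      intro x i hx
      by_contra hne
      exact Finset.disjoint_left.1 (hdisj _ _ hne) (hc x) hx
    have hP : ∀ i, (Finset.univ.filter fun x => c x = i) = P i := by
      intro i
      ext x
      simp only [Finset.mem_filter, Finset.mem_univ, true_and]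
      exact ⟨fun h => h ▸ hc x, huniq x i⟩
    refine ⟨c, ?_, funext hP⟩
    simp only [colorings, Finset.mem_filter, Finset.mem_univ, true_and, hP]
    exact ⟨hcard, fun x => huniq _ _ (hinv _ _ (hc x))⟩

/-- The ordered set partition `q.index ∘ τ⁻¹ ∘ σ⁻¹` refines the linear order of `σ` to that of
`σ * τ`. -/
theorem ofFun_mul_ofFun_perm {τ : Equiv.Perm (Fin n)}
    (hτ : descSet τ ⊆ properPartialSums q) (σ : Equiv.Perm (Fin n)) :
    LexRel.ofFun (q.index ∘ ⇑(σ * τ)⁻¹) * LexRel.ofFun ⇑σ⁻¹ = LexRel.ofFun ⇑(σ * τ)⁻¹ := by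
  rw [descSet_subset_properPartialSums_iff] at hτ
  refine LexRel.ext fun x y => ?_
  obtain ⟨u, rfl⟩ := (σ * τ).surjective x
  obtain ⟨v, rfl⟩ := (σ * τ).surjective y
  have hσ : ∀ w, σ⁻¹ ((σ * τ) w) = τ w := fun w => Equiv.symm_apply_apply σ (τ w)
  have hστ : ∀ w, (σ * τ)⁻¹ ((σ * τ) w) = w := Equiv.symm_apply_apply (σ * τ)
  simp only [LexRel.mul_apply, LexRel.ofFun_apply, Function.comp_apply, hσ, hστ]
  rcases lt_trichotomy u v with h | rfl | h
  · exact iff_of_true ⟨q.index_monotone h.le,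
      fun h' => (hτ u v h (le_antisymm (q.index_monotone h.le) h')).le⟩ h.le
  · simp
  · refine iff_of_false (fun h' => ?_) h.not_ge
    have := hτ v u h (le_antisymm (q.index_monotone h.le) h'.1)
    exact absurd (h'.2 (q.index_monotone h.le)) this.not_ge

end Composition

theorem ofFun_perm_inv_injective (n : ℕ) :
    Function.Injective fun σ : Equiv.Perm (Fin n) => LexRel.ofFun ⇑σ⁻¹ := by
  intro σ τ h
  have hmono : Monotone ⇑(τ⁻¹ * σ) := by
    intro u v huv
    have h' := congrFun (congrFun h (σ u)) (σ v)
    simp only [LexRel.ofFun] at h'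
    rw [Equiv.Perm.mul_apply, Equiv.Perm.mul_apply, ← h']
    simpa using huv
  exact (inv_mul_eq_one.1 ((Equiv.Perm.monotone_iff _).1 hmono)).symm

section DescentAlgebra

variable (n p : ℕ)

/-- The linear embedding of the group algebra into the algebra of relations sending a permutation
`σ` to the linear order of the word `σ(1), …, σ(n)`. -/
def chamberMap : GroupAlg n p →ₗ[ZMod p] MonoidAlgebra (ZMod p) (LexRel (Fin n)) :=
  MonoidAlgebra.mapDomainLinearMap (ZMod p) (ZMod p) fun σ => LexRel.ofFun ⇑σ⁻¹

theorem chamberMap_single (σ : Equiv.Perm (Fin n)) (r : ZMod p) :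
    chamberMap n p (MonoidAlgebra.single σ r) = MonoidAlgebra.single (LexRel.ofFun ⇑σ⁻¹) r :=
  MonoidAlgebra.mapDomain_single

theorem chamberMap_injective : Function.Injective (chamberMap n p) :=
  MonoidAlgebra.mapDomain_injective (ofFun_perm_inv_injective n)

variable {n}

/-- The sum of all ordered set partitions of type `q` in the algebra of relations. -/
def faceSum (q : Composition n) : MonoidAlgebra (ZMod p) (LexRel (Fin n)) :=
  ∑ c ∈ q.colorings, MonoidAlgebra.single (LexRel.ofFun c) 1

theorem faceSum_mul_chamberMap_single (q : Composition n) (σ : Equiv.Perm (Fin n)) (r : ZMod p) :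
    faceSum p q * chamberMap n p (MonoidAlgebra.single σ r) =
      chamberMap n p (MonoidAlgebra.single σ r * Bel n p q) := by
  rw [faceSum, Bel, Finset.sum_mul, Finset.mul_sum, map_sum]
  symm
  refine Finset.sum_bij (fun τ _ => q.index ∘ ⇑(σ * τ)⁻¹) ?_ ?_ ?_ ?_
  · exact fun τ _ => Composition.mem_colorings_iff.2 ⟨_, rfl⟩
  · intro τ hτ τ' hτ' h
    have h₁ := Composition.ofFun_mul_ofFun_perm (Finset.mem_filter.1 hτ).2 σ
    have h₂ := Composition.ofFun_mul_ofFun_perm (Finset.mem_filter.1 hτ').2 σ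
    rw [h, h₂] at h₁
    exact mul_left_cancel (ofFun_perm_inv_injective n h₁.symm)
  · intro c hc
    obtain ⟨π, rfl⟩ := Composition.mem_colorings_iff.1 hc
    obtain ⟨hmono, hlt⟩ := Tuple.eq_sort_iff.1 (Eq.refl (Tuple.sort (q.index ∘ ⇑(π * σ))))
    set τ := Tuple.sort (q.index ∘ ⇑(π * σ))
    have hindex : (q.index ∘ ⇑(π * σ)) ∘ ⇑τ = q.index :=
      Tuple.unique_monotone (f := q.index) (σ := π * σ * τ) (τ := 1) hmono q.index_monotone
    refine ⟨τ, Finset.mem_filter.2 ⟨Finset.mem_univ _, ?_⟩, ?_⟩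
    · rw [q.descSet_subset_properPartialSums_iff]
      intro x y hxy h
      rw [← hindex] at h
      exact hlt x y hxy h
    · funext x
      obtain ⟨y, rfl⟩ := (σ * τ).surjective x
      have : (σ * τ)⁻¹ ((σ * τ) y) = y := Equiv.symm_apply_apply (σ * τ) y
      rw [Function.comp_apply, this]
      exact (congrFun hindex y).symm
  · intro τ hτ
    rw [MonoidAlgebra.of_apply, MonoidAlgebra.single_mul_single, chamberMap_single,
      chamberMap_single, MonoidAlgebra.single_mul_single,
      Composition.ofFun_mul_ofFun_perm (Finset.mem_filter.1 hτ).2, mul_comm]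

theorem faceSum_mul_chamberMap (q : Composition n) (v : GroupAlg n p) :
    faceSum p q * chamberMap n p v = chamberMap n p (v * Bel n p q) := by
  induction v using MonoidAlgebra.induction_linear with
  | zero => simp
  | add v w hv hw => rw [map_add, mul_add, add_mul, map_add, hv, hw]
  | single σ r => exact faceSum_mul_chamberMap_single p q σ r

/-- The stabilizer characters of the algebra of relations take Young character values. -/
theorem lift_stabilizerChar_faceSum (q : Composition n) {R : LexRel (Fin n)}
    {σ : Equiv.Perm (Fin n)}
    (hσ : ∀ x y, σ.SameCycle x y ↔ (Relation.EqvGen.setoid fun x y => R x y ∧ R y x) x y) :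
    MonoidAlgebra.lift (ZMod p) (ZMod p) _ (stabilizerChar (ZMod p) LexRel.mul_mul_self R)
      (faceSum p q) = youngCharMod n p q σ := by
  rw [faceSum, map_sum, youngCharMod, Composition.youngChar_eq_card, Finset.card_filter,
    Nat.cast_sum]
  refine Finset.sum_congr rfl fun c _ => ?_
  rw [MonoidAlgebra.lift_single, one_smul, stabilizerChar_apply, Nat.cast_ite, Nat.cast_one,
    Nat.cast_zero]
  simp only [LexRel.mul_ofFun_eq_self_iff, comp_perm_eq_iff_of_sameCycle_iff hσ]

/-- Right multiplication by an element of the descent algebra is realized by left multiplication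
in the algebra of relations, compatibly with the Young character values. -/
theorem exists_mul_chamberMap_eq (φ : descentAlgebra n p →ₐ[ZMod p] (Equiv.Perm (Fin n) → ZMod p))
    (hφ : ∀ q : Composition n, φ (BelS n p q) = youngCharMod n p q) (x : descentAlgebra n p) :
    ∃ a : MonoidAlgebra (ZMod p) (LexRel (Fin n)),
      (∀ v, a * chamberMap n p v = chamberMap n p (v * x)) ∧
      ∀ (R : LexRel (Fin n)) (σ : Equiv.Perm (Fin n)),
        (∀ x y, σ.SameCycle x y ↔ (Relation.EqvGen.setoid fun x y => R x y ∧ R y x) x y) →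
        MonoidAlgebra.lift (ZMod p) (ZMod p) _ (stabilizerChar (ZMod p) LexRel.mul_mul_self R) a =
          φ x σ := by
  obtain ⟨x, hx⟩ := x
  induction hx using Algebra.adjoin_induction with
  | mem x hx =>
    obtain ⟨q, rfl⟩ := hx
    refine ⟨faceSum p q, faceSum_mul_chamberMap p q, fun R σ hσ => ?_⟩
    rw [lift_stabilizerChar_faceSum p q hσ, ← hφ]
    rfl
  | algebraMap r =>
    refine ⟨algebraMap _ _ r, fun v => ?_, fun R σ _ => ?_⟩
    · change _ = chamberMap n p (v * algebraMap _ _ r)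
      rw [← Algebra.commutes, ← Algebra.smul_def, ← Algebra.smul_def, map_smul]
    · rw [AlgHom.commutes]
      exact (congrFun (φ.commutes r) σ).symm
  | add x y hx hy ihx ihy =>
    obtain ⟨a, ha, ha'⟩ := ihx
    obtain ⟨b, hb, hb'⟩ := ihy
    refine ⟨a + b, fun v => ?_, fun R σ hσ => ?_⟩
    · rw [add_mul, ha, hb, ← map_add, ← mul_add]
    · rw [map_add, ha' R σ hσ, hb' R σ hσ]
      exact (congrFun (φ.map_add ⟨x, hx⟩ ⟨y, hy⟩) σ).symm
  | mul x y hx hy ihx ihy =>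
    obtain ⟨a, ha, ha'⟩ := ihx
    obtain ⟨b, hb, hb'⟩ := ihy
    refine ⟨b * a, fun v => ?_, fun R σ hσ => ?_⟩
    · rw [mul_assoc, ha, hb, mul_assoc]
    · rw [map_mul, ha' R σ hσ, hb' R σ hσ, mul_comm]
      exact (congrFun (φ.map_mul ⟨x, hx⟩ ⟨y, hy⟩) σ).symm

theorem isNilpotent_of_apply_eq_zero
    (φ : descentAlgebra n p →ₐ[ZMod p] (Equiv.Perm (Fin n) → ZMod p))
    (hφ : ∀ q : Composition n, φ (BelS n p q) = youngCharMod n p q) {x : descentAlgebra n p}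
    (hx : φ x = 0) : IsNilpotent x := by
  obtain ⟨a, ha, hchar⟩ := exists_mul_chamberMap_eq p φ hφ x
  obtain ⟨m, hm⟩ : IsNilpotent a := by
    refine isNilpotent_of_stabilizerChar_eq_zero LexRel.mul_mul_self fun R => ?_
    obtain ⟨σ, hσ⟩ := exists_perm_sameCycle_iff
      (Relation.EqvGen.setoid fun x y => R x y ∧ R y x)
    rw [hchar R σ hσ, hx, Pi.zero_apply]
  have hpow : ∀ m : ℕ, a ^ m * chamberMap n p 1 = chamberMap n p ((x : GroupAlg n p) ^ m) := by
    intro m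
    induction m with
    | zero => rw [pow_zero, pow_zero, one_mul]
    | succ m ih => rw [pow_succ', mul_assoc, ih, ha, pow_succ]
  refine ⟨m, Subtype.ext (chamberMap_injective n p ?_)⟩
  rw [Subalgebra.coe_pow, ← hpow, hm, zero_mul, ZeroMemClass.coe_zero, map_zero]

end DescentAlgebra

/-- A surjective homomorphism from a ring to a field kills the Jacobson radical. -/
theorem map_eq_zero_of_mem_jacobson_bot {R K : Type*} [Ring R] [Field K] (f : R →+* K)
    (hf : Function.Surjective f) {x : R} (hx : x ∈ (⊥ : Ideal R).jacobson) : f x = 0 := by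
  by_contra h
  obtain ⟨y, hy⟩ := hf (-(f x)⁻¹)
  obtain ⟨z, hz⟩ := Ideal.mem_jacobson_iff.1 hx y
  have := congrArg f (Ideal.mem_bot.1 hz)
  simp [hy, h] at this

/-- The Jacobson radical `R(n,p)` of `Σ(n,p)` equals the kernel of the
homomorphism `φ : Σ(n,p) → G(n,p)` determined by `φ(B̄_q) = χ̃_q`. -/
theorem stmt9 (n p : ℕ) (hn : 1 ≤ n) (hp : p.Prime)
    (φ : descentAlgebra n p →ₐ[ZMod p] (Equiv.Perm (Fin n) → ZMod p))
    (hφ : ∀ q : Composition n, φ (BelS n p q) = youngCharMod n p q) :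
    descentRadical n p = RingHom.ker φ.toRingHom := by
  have := Fact.mk hp
  ext x
  rw [RingHom.mem_ker]
  constructor
  · intro hx
    funext σ
    refine map_eq_zero_of_mem_jacobson_bot
      ((Pi.evalRingHom (fun _ => ZMod p) σ).comp φ.toRingHom) (fun r => ?_) hx
    exact ⟨algebraMap _ _ r, congrFun (φ.commutes r) σ⟩
  · intro hx
    refine Ideal.mem_jacobson_iff.2 fun y => ?_
    have hyx : IsNilpotent (y * x) := by
      refine isNilpotent_of_apply_eq_zero p φ hφ ?_
      rw [map_mul, show φ x = 0 from hx, mul_zero]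
    obtain ⟨u, hu⟩ := hyx.isUnit_add_one
    refine ⟨↑u⁻¹, ?_⟩
    rw [Ideal.mem_bot, mul_assoc, ← mul_add_one, ← hu, Units.inv_mul, sub_self]

end
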